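/- arXiv:2011.13346 — 2 statements merged into one kernel-verified Lean document; each statement's English description precedes it below -/
import Mathlib

section
/- Let f(t) = Σ_{j=1}^K γ_j cos(2π a_j t + b_j) with γ_j ∈ (0,∞), pairwise distinct a_j ∈ (0,∞), b_j ∈ [0,2π), P > 0, and a_j P ∉ ℕ for all j. With C_j = a_j² P², A_j = −(P γ_j a_j/π) sin(a_j πP) cos(a_j πP + b_j), B_j = −(γ_j/π) sin(a_j πP) sin(a_j πP + b_j), define the polynomials q_K(z) = Π_{j=1}^K (z − C_j) and p_{K−1}(z) = Σ_{j=1}^K (A_j + i B_j) Π_{ℓ≠j} (z − C_ℓ). Then q_K is monic of degree K, p_{K−1} has degree at most K−1, p_{K−1} and q_K are coprime in ℂ[z], and for every n ∈ ℕ the modified Fourier coefficient satisfies c̃_n(f) := Re c_n(f) + (i/n) Im c_n(f) = p_{K−1}(n²)/q_K(n²). -/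
open Real Finset Polynomial

/-- The classical Fourier coefficient `c_n(f)` of `f : ℝ → ℝ` with respect to the
interval `(0, P)`: `c_n(f) = (1/P) ∫₀^P f(t) e^{-2πi n t / P} dt`. -/
noncomputable def fourierCoef (P : ℝ) (f : ℝ → ℝ) (n : ℤ) : ℂ :=
  (1 / (P : ℂ)) * ∫ t in (0:ℝ)..P,
    (f t : ℂ) * Complex.exp (-2 * (π : ℂ) * Complex.I * (n : ℂ) * (t : ℂ) / (P : ℂ))

theorem fourierCoef_cos {P : ℝ} (hP : 0 < P) {α : ℝ} (hα : 0 < α) (β : ℝ)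
    (hnp : ∀ m : ℕ, α * P ≠ m) (n : ℕ) :
    fourierCoef P (fun t => Real.cos (2 * π * α * t + β)) n =
      ((-(P * α / π) * Real.sin (α * π * P) * Real.cos (α * π * P + β) : ℝ)
        + Complex.I * n * (-(1 / π) * Real.sin (α * π * P) * Real.sin (α * π * P + β) : ℝ))
        / ((n : ℂ) ^ 2 - (α ^ 2 * P ^ 2 : ℝ)) := by
  have hP' : (P : ℂ) ≠ 0 := mod_cast hP.ne'
  have hπ : (π : ℂ) ≠ 0 := mod_cast Real.pi_ne_zero
  have hsub : (α * P - n : ℂ) ≠ 0 := by exact_mod_cast sub_ne_zero.2 (hnp n)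
  have hadd : (α * P + n : ℂ) ≠ 0 := by
    have : (0 : ℝ) < α * P + n := by positivity
    exact_mod_cast this.ne'
  have hden : ((n : ℂ) ^ 2 - (α : ℂ) ^ 2 * P ^ 2) ≠ 0 := by
    have : ((n : ℂ) ^ 2 - (α : ℂ) ^ 2 * P ^ 2) = -((α * P - n) * (α * P + n)) := by ring
    rw [this]
    exact neg_ne_zero.2 (mul_ne_zero hsub hadd)
  set u : ℂ := 2 * π * Complex.I * (α * P - n) / P with hu
  set v : ℂ := -(2 * π * Complex.I * (α * P + n) / P) with hv
  have hu0 : u ≠ 0 := by simp [hu, hπ, hP', hsub]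
  have hv0 : v ≠ 0 := by simp [hv, hπ, hP', hadd]
  set e : ℂ := Complex.exp (β * Complex.I) with he
  set E : ℂ := Complex.exp (α * π * P * Complex.I) with hE
  have he0 : e ≠ 0 := Complex.exp_ne_zero _
  have hE0 : E ≠ 0 := Complex.exp_ne_zero _
  have hn : Complex.exp (n * (2 * π * Complex.I)) = 1 := Complex.exp_nat_mul_two_pi_mul_I n
  have huP : Complex.exp (u * P) = E ^ 2 := by
    have : u * P = (2 : ℕ) * (α * π * P * Complex.I) - n * (2 * π * Complex.I) := by
      rw [hu]; field_simp; push_cast; ring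
    rw [this, Complex.exp_sub, hn, Complex.exp_nat_mul, div_one]
  have hvP : Complex.exp (v * P) = (E ^ 2)⁻¹ := by
    have : v * P = -((2 : ℕ) * (α * π * P * Complex.I)) - n * (2 * π * Complex.I) := by
      rw [hv]; field_simp; push_cast; ring
    rw [this, Complex.exp_sub, hn, Complex.exp_neg, Complex.exp_nat_mul, div_one]
  have hint : ∀ t : ℝ, ((Real.cos (2 * π * α * t + β) : ℝ) : ℂ)
      * Complex.exp (-2 * (π : ℂ) * Complex.I * ((n : ℤ) : ℂ) * (t : ℂ) / (P : ℂ))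
      = e / 2 * Complex.exp (u * t) + e⁻¹ / 2 * Complex.exp (v * t) := by
    intro t
    have h1 : Complex.exp ((2 * π * α * t + β) * Complex.I)
        * Complex.exp (-2 * π * Complex.I * n * t / P) = e * Complex.exp (u * t) := by
      rw [he, ← Complex.exp_add, ← Complex.exp_add, hu]
      congr 1
      field_simp
      ring
    have h2 : Complex.exp (-(2 * π * α * t + β) * Complex.I)
        * Complex.exp (-2 * π * Complex.I * n * t / P) = e⁻¹ * Complex.exp (v * t) := by
      rw [he, ← Complex.exp_neg, ← Complex.exp_add, ← Complex.exp_add, hv]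
      congr 1
      field_simp
      ring
    rw [Complex.ofReal_cos, Complex.cos]
    push_cast
    linear_combination (h1 + h2) / 2
  have hcont : ∀ c w : ℂ, IntervalIntegrable (fun t : ℝ => c * Complex.exp (w * t))
      MeasureTheory.volume 0 P := fun c w =>
    Continuous.intervalIntegrable (by fun_prop) _ _
  unfold fourierCoef
  simp_rw [hint]
  rw [intervalIntegral.integral_add (hcont _ _) (hcont _ _),
    intervalIntegral.integral_const_mul, intervalIntegral.integral_const_mul,
    integral_exp_mul_complex hu0, integral_exp_mul_complex hv0, huP, hvP]
  have hs : Complex.sin (α * π * P) = (E⁻¹ - E) * Complex.I / 2 := by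
    rw [Complex.sin, neg_mul, Complex.exp_neg]
  have hexp : Complex.exp ((α * π * P + β) * Complex.I) = E * e := by
    rw [add_mul, Complex.exp_add]
  have hc' : Complex.cos (α * π * P + β) = (E * e + (E * e)⁻¹) / 2 := by
    rw [Complex.cos, neg_mul, Complex.exp_neg, hexp]
  have hs' : Complex.sin (α * π * P + β) = ((E * e)⁻¹ - E * e) * Complex.I / 2 := by
    rw [Complex.sin, neg_mul, Complex.exp_neg, hexp]
  push_cast
  rw [hs, hc', hs', hu, hv, eq_div_iff hden]
  have hfac : ((n : ℂ) ^ 2 - (α : ℂ) ^ 2 * P ^ 2) = -((α * P - n) * (α * P + n)) := by ring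
  rw [hfac]
  have hsub' : (P * α - n : ℂ) ≠ 0 := by rwa [mul_comm]
  have hadd' : (P * α + n : ℂ) ≠ 0 := by rwa [mul_comm]
  clear_value e E
  simp only [mul_zero, Complex.exp_zero]
  field_simp
  ring_nf
  simp only [Complex.I_sq, Complex.I_pow_four]
  ring

theorem fourierCoef_sum_mul {ι : Type*} (s : Finset ι) (P : ℝ) (c : ι → ℝ) (g : ι → ℝ → ℝ)
    (hg : ∀ j ∈ s, Continuous (g j)) (n : ℤ) :
    fourierCoef P (fun t => ∑ j ∈ s, c j * g j t) n = ∑ j ∈ s, c j * fourierCoef P (g j) n := by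
  unfold fourierCoef
  simp_rw [Complex.ofReal_sum, Finset.sum_mul, Complex.ofReal_mul, mul_assoc]
  rw [intervalIntegral.integral_finsetSum]
  · rw [Finset.mul_sum]
    refine Finset.sum_congr rfl fun j _ => ?_
    rw [intervalIntegral.integral_const_mul]
    ring
  · intro j hj
    have := hg j hj
    exact Continuous.intervalIntegrable (by fun_prop) _ _

/-- **The modified Fourier coefficients are values of a rational function of type
`(K−1, K)`.** With `q_K(z) = Π_j (z − C_j)` and `p_{K−1}(z) = Σ_j (A_j + iB_j) Π_{ℓ≠j} (z − C_ℓ)`,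
the polynomial `q_K` is monic of degree `K`, `p_{K−1}` has degree at most `K−1`, the two are
coprime, and for every `n ∈ ℕ` the modified Fourier coefficient
`c̃_n(f) = Re c_n(f) + (i/n) Im c_n(f)` equals `p_{K−1}(n²)/q_K(n²)`. -/
theorem statement6 (P : ℝ) (hP : 0 < P) (K : ℕ) (hK : 0 < K)
    (γ a b : Fin K → ℝ) (hγ : ∀ j, 0 < γ j) (ha : ∀ j, 0 < a j)
    (hainj : Function.Injective a) (hb : ∀ j, b j ∈ Set.Ico 0 (2 * π))
    (hnp : ∀ j, ∀ m : ℕ, a j * P ≠ (m : ℝ))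
    (f : ℝ → ℝ) (hf : ∀ t, f t = ∑ j, γ j * Real.cos (2 * π * a j * t + b j))
    (Cp Ap Bp : Fin K → ℝ)
    (hCp : ∀ j, Cp j = (a j) ^ 2 * P ^ 2)
    (hAp : ∀ j, Ap j = -(P * γ j * a j / π)
      * Real.sin (a j * π * P) * Real.cos (a j * π * P + b j))
    (hBp : ∀ j, Bp j = -(γ j / π)
      * Real.sin (a j * π * P) * Real.sin (a j * π * P + b j))
    (q p : Polynomial ℂ)
    (hq : q = ∏ j, (X - C ((Cp j : ℂ))))
    (hp : p = ∑ j, C ((Ap j : ℂ) + Complex.I * (Bp j : ℂ))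
      * ∏ ℓ ∈ univ.erase j, (X - C ((Cp ℓ : ℂ)))) :
    q.Monic ∧ q.natDegree = K ∧ p.natDegree ≤ K - 1 ∧ IsCoprime p q ∧
      ∀ n : ℕ, 0 < n →
        ((fourierCoef P f n).re : ℂ) + Complex.I / (n : ℂ) * ((fourierCoef P f n).im : ℂ)
          = p.eval ((n : ℂ) ^ 2) / q.eval ((n : ℂ) ^ 2) := by
  have hCinj : ∀ i j, i ≠ j → (Cp i : ℂ) ≠ Cp j := by
    intro i j hij h
    have h' : Cp i = Cp j := mod_cast h
    rw [hCp, hCp, mul_left_inj' (by positivity)] at h'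
    exact hij (hainj ((pow_left_inj₀ (ha i).le (ha j).le two_ne_zero).1 h'))
  have hres : ∀ j, (Ap j : ℂ) + Complex.I * (Bp j : ℂ) ≠ 0 := by
    intro j h
    have hA : Ap j = 0 := by simpa using congrArg Complex.re h
    have hB : Bp j = 0 := by simpa using congrArg Complex.im h
    have hsin : Real.sin (a j * π * P) ≠ 0 := by
      intro h0
      obtain ⟨m, hm⟩ := Real.sin_eq_zero_iff.1 h0
      have hm' : (m : ℝ) = a j * P := mul_right_cancel₀ Real.pi_ne_zero (by linarith)
      have hpos : (0 : ℝ) < m := hm' ▸ mul_pos (ha j) hP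
      lift m to ℕ using (by exact_mod_cast hpos.le)
      exact hnp j m (by rw [← hm']; simp)
    have hγ' := (hγ j).ne'
    have ha' := (ha j).ne'
    have hcos0 : Real.cos (a j * π * P + b j) = 0 := by
      simpa [hAp, hsin, hγ', ha', hP.ne', Real.pi_ne_zero] using hA
    have hsin0 : Real.sin (a j * π * P + b j) = 0 := by
      simpa [hBp, hsin, hγ', Real.pi_ne_zero] using hB
    simpa [hcos0, hsin0] using Real.sin_sq_add_cos_sq (a j * π * P + b j)
  refine ⟨?_, ?_, ?_, ?_, ?_⟩
  · rw [hq]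
    exact monic_prod_X_sub_C _ _
  · simp [hq]
  · rw [hp]
    refine natDegree_sum_le_of_forall_le _ _ fun j _ => ?_
    refine (natDegree_C_mul_le _ _).trans (le_of_eq ?_)
    rw [natDegree_finsetProd_X_sub_C_eq_card, card_erase_of_mem (mem_univ j), card_univ,
      Fintype.card_fin]
  · rw [hq]
    refine IsCoprime.prod_right fun i _ => ?_
    refine IsCoprime.symm ((irreducible_X_sub_C _).coprime_iff_not_dvd.2 ?_)
    rw [dvd_iff_isRoot, IsRoot.def, hp, eval_finsetSum, sum_eq_single i]
    · rw [eval_mul, eval_C, eval_prod]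
      refine mul_ne_zero (hres i) (prod_ne_zero_iff.2 fun l hl => ?_)
      simpa using sub_ne_zero.2 (hCinj i l (ne_of_mem_erase hl).symm)
    · intro j _ hj
      rw [eval_mul, eval_prod, prod_eq_zero (mem_erase.2 ⟨hj.symm, mem_univ i⟩) (by simp),
        mul_zero]
    · simp
  · intro n hn
    have hn0 : (n : ℂ) ≠ 0 := mod_cast hn.ne'
    have hden : ∀ j, (n : ℂ) ^ 2 - Cp j ≠ 0 := by
      intro j h
      have h' : (n : ℝ) ^ 2 = (a j * P) ^ 2 := by
        rw [mul_pow, ← hCp]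
        exact_mod_cast sub_eq_zero.1 h
      have haP := mul_pos (ha j) hP
      exact hnp j n ((pow_left_inj₀ (by positivity) haP.le two_ne_zero).1 h').symm
    have hcoef : fourierCoef P f n =
        ((∑ j, Ap j / ((n : ℝ) ^ 2 - Cp j) : ℝ) : ℂ)
          + ((n * ∑ j, Bp j / ((n : ℝ) ^ 2 - Cp j) : ℝ) : ℂ) * Complex.I := by
      rw [show f = fun t => ∑ j, γ j * Real.cos (2 * π * a j * t + b j) from funext hf,
        fourierCoef_sum_mul _ _ _ (fun j t => Real.cos (2 * π * a j * t + b j))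
          (fun j _ => by fun_prop)]
      push_cast
      rw [mul_sum, sum_mul, ← sum_add_distrib]
      refine sum_congr rfl fun j _ => ?_
      rw [fourierCoef_cos hP (ha j) _ (hnp j), ← hCp, hAp, hBp]
      have := hden j
      push_cast
      field_simp
    have hre : (fourierCoef P f n).re = ∑ j, Ap j / ((n : ℝ) ^ 2 - Cp j) := by
      simp only [hcoef, Complex.add_re, Complex.ofReal_re, Complex.re_ofReal_mul, Complex.I_re,
        mul_zero, add_zero]
    have him : (fourierCoef P f n).im = n * ∑ j, Bp j / ((n : ℝ) ^ 2 - Cp j) := by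
      simp only [hcoef, Complex.add_im, Complex.ofReal_im, Complex.im_ofReal_mul, Complex.I_im,
        mul_one, zero_add]
    rw [hre, him, hp, hq, eval_finsetSum, eval_prod, sum_div]
    push_cast
    rw [← mul_assoc, div_mul_cancel₀ _ hn0, mul_sum, ← sum_add_distrib]
    refine sum_congr rfl fun j _ => ?_
    rw [eval_mul, eval_C, eval_prod, ← mul_prod_erase univ _ (mem_univ j)]
    have hne : ∏ l ∈ univ.erase j, eval ((n : ℂ) ^ 2) (X - C (Cp l : ℂ)) ≠ 0 :=
      prod_ne_zero_iff.2 fun l _ => by simpa using hden l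
    rw [mul_div_mul_right _ _ hne, eval_sub, eval_X, eval_C]
    ring
end

section
/- Let P > 0 and K ∈ ℕ. Let f(t) = Σ_{j=1}^{K₁} γ_j cos(2π a_j t + b_j) and g(t) = Σ_{j=1}^{K₂} δ_j cos(2π c_j t + d_j) with K₁ ≤ K, K₂ ≤ K, γ_j, δ_j ∈ (0,∞), b_j, d_j ∈ [0,2π), the a_j ∈ (0,∞) pairwise distinct with a_j P ∉ ℕ, and the c_j ∈ (0,∞) pairwise distinct with c_j P ∉ ℕ. If there exist 2K pairwise distinct positive integers n_1, …, n_{2K} such that c_{n_m}(f) = c_{n_m}(g) for m = 1,…,2K, then f(t) = g(t) for all t ∈ ℝ. -/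
open Real Finset

/-- **Nonsingularity of Cauchy systems.** A combination of simple fractions `y i / (v i - X)`
with distinct poles that vanishes at at least as many points as it has terms is trivial. -/
theorem eq_zero_of_sum_div_sub_eq_zero {F ι κ : Type*} [Field F] [DecidableEq ι]
    (S : Finset ι) (T : Finset κ) (v y : ι → F) (w : κ → F) (hv : Set.InjOn v S)
    (hw : Set.InjOn w T) (hcard : #S ≤ #T) (hne : ∀ i ∈ S, ∀ k ∈ T, v i ≠ w k)
    (h : ∀ k ∈ T, ∑ i ∈ S, y i / (v i - w k) = 0) : ∀ i ∈ S, y i = 0 := by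
  set p : Polynomial F := ∑ i ∈ S, Polynomial.C (y i) *
    ∏ j ∈ S.erase i, (Polynomial.C (v j) - Polynomial.X) with hp
  have hdeg : p.degree < #T := by
    refine (Polynomial.degree_sum_le _ _).trans_lt ((Finset.sup_lt_iff ?_).2 fun i hi => ?_)
    · exact WithBot.bot_lt_coe _
    · have hprod : (∏ j ∈ S.erase i, (Polynomial.C (v j) - Polynomial.X)).degree
          ≤ (#(S.erase i) : WithBot ℕ) := by
        refine (Polynomial.degree_prod_le _ _).trans ?_
        refine (Finset.sum_le_card_nsmul _ _ 1 fun j _ => ?_).trans (by simp)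
        refine (Polynomial.degree_sub_le _ _).trans (max_le ?_ ?_)
        · exact Polynomial.degree_C_le.trans (by norm_num)
        · exact Polynomial.degree_X_le
      refine (Polynomial.degree_mul_le_of_le Polynomial.degree_C_le hprod).trans_lt ?_
      rw [zero_add]
      exact_mod_cast (Finset.card_erase_lt_of_mem hi).trans_le hcard
  have heval : ∀ k ∈ T, p.eval (w k) = 0 := by
    intro k hk
    have hfac : p.eval (w k) =
        (∏ j ∈ S, (v j - w k)) * ∑ i ∈ S, y i / (v i - w k) := by
      rw [hp, Polynomial.eval_finsetSum, Finset.mul_sum]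
      refine Finset.sum_congr rfl fun i hi => ?_
      have hi0 := sub_ne_zero.2 (hne i hi k hk)
      simp only [Polynomial.eval_mul, Polynomial.eval_C, Polynomial.eval_prod,
        Polynomial.eval_sub, Polynomial.eval_X]
      rw [← Finset.mul_prod_erase S _ hi]
      field_simp
    rw [hfac, h k hk, mul_zero]
  have hp0 : p = 0 :=
    Polynomial.eq_zero_of_degree_lt_of_eval_index_eq_zero T hw hdeg heval
  intro i hi
  have hpi : p.eval (v i) = y i * ∏ j ∈ S.erase i, (v j - v i) := by
    rw [hp, Polynomial.eval_finsetSum, Finset.sum_eq_single_of_mem i hi]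
    · simp [Polynomial.eval_prod]
    · intro j _ hji
      have hmem : i ∈ S.erase j := Finset.mem_erase.2 ⟨hji.symm, hi⟩
      simp [Polynomial.eval_prod, Finset.prod_eq_zero hmem]
  rw [hp0, Polynomial.eval_zero] at hpi
  refine (mul_eq_zero.1 hpi.symm).resolve_right (Finset.prod_ne_zero_iff.2 fun j hj => ?_)
  rw [Finset.mem_erase] at hj
  exact sub_ne_zero.2 fun e => hj.1 (hv hj.2 hi e)

/-- The Fourier coefficient of a single oscillation `Re (z e^{2πixt})`. -/
theorem fourierCoef_re_mul_exp {P : ℝ} (hP : 0 < P) (x : ℝ) (z : ℂ) (n : ℤ)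
    (h₁ : x * P - n ≠ 0) (h₂ : x * P + n ≠ 0) :
    fourierCoef P (fun t => (z * Complex.exp (2 * π * x * t * Complex.I)).re) n =
      1 / (4 * π * Complex.I) *
        (z * (Complex.exp (2 * π * (x * P) * Complex.I) - 1) / ((x * P - n : ℝ) : ℂ) -
          (starRingEnd ℂ) (z * (Complex.exp (2 * π * (x * P) * Complex.I) - 1)) /
            ((x * P + n : ℝ) : ℂ)) := by
  have hPc : (P : ℂ) ≠ 0 := by exact_mod_cast hP.ne'
  have hπ : (π : ℂ) ≠ 0 := by exact_mod_cast pi_ne_zero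
  have hI := Complex.I_ne_zero
  have h₁c : (x * P - n : ℂ) ≠ 0 := by exact_mod_cast h₁
  have h₂c : (x * P + n : ℂ) ≠ 0 := by exact_mod_cast h₂
  set u : ℂ := 2 * π * Complex.I * (x * P - n) / P with hu
  set u' : ℂ := -(2 * π * Complex.I * (x * P + n)) / P with hu'
  have hu0 : u ≠ 0 := by rw [hu]; exact div_ne_zero (mul_ne_zero Complex.two_pi_I_ne_zero h₁c) hPc
  have hu'0 : u' ≠ 0 := by
    rw [hu']; exact div_ne_zero (neg_ne_zero.2 (mul_ne_zero Complex.two_pi_I_ne_zero h₂c)) hPc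
  have hint : ∀ t : ℝ, (((z * Complex.exp (2 * π * x * t * Complex.I)).re : ℝ) : ℂ) *
      Complex.exp (-2 * (π : ℂ) * Complex.I * (n : ℂ) * (t : ℂ) / (P : ℂ)) =
      z / 2 * Complex.exp (u * t) + (starRingEnd ℂ) z / 2 * Complex.exp (u' * t) := by
    intro t
    rw [Complex.re_eq_add_conj, map_mul, ← Complex.exp_conj]
    have e₁ : Complex.exp (u * t) = Complex.exp (2 * π * x * t * Complex.I) *
        Complex.exp (-2 * (π : ℂ) * Complex.I * (n : ℂ) * (t : ℂ) / (P : ℂ)) := by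
      rw [← Complex.exp_add]; congr 1; rw [hu]; field_simp; ring
    have e₂ : Complex.exp (u' * t) =
        Complex.exp ((starRingEnd ℂ) (2 * π * x * t * Complex.I)) *
        Complex.exp (-2 * (π : ℂ) * Complex.I * (n : ℂ) * (t : ℂ) / (P : ℂ)) := by
      rw [← Complex.exp_add]; congr 1; rw [hu']; simp [Complex.conj_ofNat]; field_simp; ring
    rw [e₁, e₂]; ring
  have hexp : Complex.exp (u * P) = Complex.exp (2 * π * (x * P) * Complex.I) := by
    rw [show u * P = 2 * π * (x * P) * Complex.I - n * (2 * π * Complex.I) by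
      rw [hu]; field_simp, Complex.exp_sub, Complex.exp_int_mul_two_pi_mul_I, div_one]
  have hexp' : Complex.exp (u' * P) =
      (starRingEnd ℂ) (Complex.exp (2 * π * (x * P) * Complex.I)) := by
    rw [← Complex.exp_conj, show u' * P =
      (starRingEnd ℂ) (2 * π * (x * P) * Complex.I) - n * (2 * π * Complex.I) by
      rw [hu']; simp [Complex.conj_ofNat]; field_simp; ring, Complex.exp_sub, Complex.exp_int_mul_two_pi_mul_I,
      div_one]
  unfold fourierCoef
  simp_rw [hint]
  rw [intervalIntegral.integral_add, intervalIntegral.integral_const_mul,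
    intervalIntegral.integral_const_mul, integral_exp_mul_complex hu0,
    integral_exp_mul_complex hu'0, hexp, hexp']
  · simp only [Complex.ofReal_zero, mul_zero, Complex.exp_zero, map_mul, map_sub, map_one, hu, hu']
    push_cast
    field_simp
    ring
  · exact (Continuous.intervalIntegrable (by fun_prop) _ _)
  · exact (Continuous.intervalIntegrable (by fun_prop) _ _)

theorem fourierCoef_sum {ι : Type*} (P : ℝ) (S : Finset ι) (F : ι → ℝ → ℝ)
    (hF : ∀ i ∈ S, Continuous (F i)) (n : ℤ) :
    fourierCoef P (fun t => ∑ i ∈ S, F i t) n = ∑ i ∈ S, fourierCoef P (F i) n := by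
  unfold fourierCoef
  simp only [Complex.ofReal_sum, Finset.sum_mul]
  rw [intervalIntegral.integral_finsetSum, Finset.mul_sum]
  intro i hi
  have := hF i hi
  exact Continuous.intervalIntegrable (by fun_prop) _ _

theorem fourierCoef_sub (P : ℝ) {f g : ℝ → ℝ} (hf : Continuous f) (hg : Continuous g) (n : ℤ) :
    fourierCoef P (fun t => f t - g t) n = fourierCoef P f n - fourierCoef P g n := by
  unfold fourierCoef
  simp only [Complex.ofReal_sub, sub_mul]
  rw [intervalIntegral.integral_sub, mul_sub]
  · exact Continuous.intervalIntegrable (by fun_prop) _ _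
  · exact Continuous.intervalIntegrable (by fun_prop) _ _

/-- A sum of oscillations with non-`P`-periodic positive frequencies, at least as many of whose
positive-index Fourier coefficients vanish as it has terms, has zero amplitudes. -/
theorem amplitude_eq_zero_of_fourierCoef_eq_zero {κ : Type*} {P : ℝ} (hP : 0 < P)
    (S : Finset ℝ) (z : ℝ → ℂ) (hpos : ∀ x ∈ S, 0 < x)
    (hnp : ∀ x ∈ S, ∀ m : ℕ, x * P ≠ m) (T : Finset κ) (idx : κ → ℕ)
    (hidx : ∀ k ∈ T, 0 < idx k) (hinj : Set.InjOn idx T) (hcard : #S ≤ #T)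
    (h : ∀ k ∈ T, fourierCoef P
      (fun t => ∑ x ∈ S, (z x * Complex.exp (2 * π * x * t * Complex.I)).re) (idx k : ℤ) = 0) :
    ∀ x ∈ S, z x = 0 := by
  set A : ℝ → ℂ := fun x => z x * (Complex.exp (2 * π * (x * P) * Complex.I) - 1) with hA
  have hsub : ∀ x ∈ S, ∀ k, x * P - idx k ≠ 0 := fun x hx k => sub_ne_zero.2 (hnp x hx _)
  have hadd : ∀ x ∈ S, ∀ k, x * P + idx k ≠ 0 := fun x hx k => by
    have := mul_pos (hpos x hx) hP
    positivity
  have hsum : ∀ k ∈ T, ∑ x ∈ S, (A x / ((x * P - idx k : ℝ) : ℂ) -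
      (starRingEnd ℂ) (A x) / ((x * P + idx k : ℝ) : ℂ)) = 0 := by
    intro k hk
    have hk0 := h k hk
    rw [fourierCoef_sum _ _ _ fun x _ => by fun_prop] at hk0
    rw [Finset.sum_congr rfl fun x hx => fourierCoef_re_mul_exp hP x (z x) (idx k : ℤ)
      (by exact_mod_cast hsub x hx k) (by exact_mod_cast hadd x hx k), ← Finset.mul_sum] at hk0
    have hc : (1 / (4 * π * Complex.I) : ℂ) ≠ 0 := by simp [pi_ne_zero]
    simpa [hA] using (mul_eq_zero.1 hk0).resolve_left hc
  have hsq : ∀ x ∈ S, ∀ k ∈ T, (x * P) ^ 2 ≠ (idx k : ℝ) ^ 2 := fun x hx k _ e => by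
    refine mul_ne_zero (hsub x hx k) (hadd x hx k) ?_
    linear_combination e
  have hv : Set.InjOn (fun x : ℝ => (x * P) ^ 2) S := fun x hx y hy e =>
    mul_right_cancel₀ hP.ne' ((pow_left_inj₀ (mul_pos (hpos x hx) hP).le
      (mul_pos (hpos y hy) hP).le two_ne_zero).1 e)
  have hw : Set.InjOn (fun k => (idx k : ℝ) ^ 2) T := fun k hk l hl e => by
    refine hinj hk hl ?_
    exact_mod_cast (pow_left_inj₀ (Nat.cast_nonneg (α := ℝ) _) (Nat.cast_nonneg _)
      two_ne_zero).1 e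
  have hre := eq_zero_of_sum_div_sub_eq_zero S T _ (fun x => (A x).re) _ hv hw hcard hsq
    fun k hk => by
      have e := congrArg Complex.re (hsum k hk)
      rw [Complex.re_sum] at e
      have hn : (2 * idx k : ℝ) ≠ 0 := by have := hidx k hk; positivity
      refine ((mul_eq_zero (a := (2 * idx k : ℝ))).1 ?_).resolve_left hn
      rw [Finset.mul_sum]
      refine Eq.trans (Finset.sum_congr rfl fun x hx => ?_) e
      have h₁ := hsub x hx k
      have h₂ := hadd x hx k
      have h₃ := sub_ne_zero.2 (hsq x hx k hk)
      simp only [Complex.sub_re, Complex.div_ofReal_re, Complex.conj_re]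
      rw [show (x * P) ^ 2 - (idx k : ℝ) ^ 2 = (x * P - idx k) * (x * P + idx k) by ring]
      field_simp
      ring
  have him := eq_zero_of_sum_div_sub_eq_zero S T _ (fun x => 2 * (x * P) * (A x).im) _ hv hw
    hcard hsq fun k hk => by
      have e := congrArg Complex.im (hsum k hk)
      rw [Complex.im_sum] at e
      refine Eq.trans (Finset.sum_congr rfl fun x hx => ?_) e
      have h₁ := hsub x hx k
      have h₂ := hadd x hx k
      simp only [Complex.sub_im, Complex.div_ofReal_im, Complex.conj_im]
      rw [show (x * P) ^ 2 - (idx k : ℝ) ^ 2 = (x * P - idx k) * (x * P + idx k) by ring]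
      field_simp
      ring
  intro x hx
  have hxP := mul_pos (hpos x hx) hP
  have hA0 : A x = 0 :=
    Complex.ext (hre x hx) ((mul_eq_zero.1 (him x hx)).resolve_left (by positivity))
  refine (mul_eq_zero.1 hA0).resolve_right fun e => ?_
  obtain ⟨m, hm⟩ := Complex.exp_eq_one_iff.1 (sub_eq_zero.1 e)
  have hxm : x * P = m := by
    have : (x * P : ℂ) = m := mul_right_cancel₀ Complex.two_pi_I_ne_zero (by linear_combination hm)
    exact_mod_cast this
  have hm0 : 0 ≤ m := by
    have : (0 : ℝ) < m := hxm ▸ hxP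
    exact_mod_cast this.le
  lift m to ℕ using hm0
  exact hnp x hx m (by exact_mod_cast hxm)

/-- Grouping the terms of a sum of cosines by frequency. -/
theorem sum_mul_cos_eq_sum_re {ι : Type*} [Fintype ι] (S : Finset ℝ) (γ a b : ι → ℝ)
    (hS : ∀ j, a j ∈ S) (t : ℝ) :
    ∑ j, γ j * Real.cos (2 * π * a j * t + b j) =
      ∑ x ∈ S, ((∑ j with a j = x, (γ j : ℂ) * Complex.exp (b j * Complex.I)) *
        Complex.exp (2 * π * x * t * Complex.I)).re := by
  rw [← Finset.sum_fiberwise_of_maps_to (t := S) (g := a) fun j _ => hS j]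
  refine Finset.sum_congr rfl fun x _ => ?_
  rw [Finset.sum_mul, Complex.re_sum]
  refine Finset.sum_congr rfl fun j hj => ?_
  rw [← (Finset.mem_filter.1 hj).2, mul_assoc (γ j : ℂ), ← Complex.exp_add, Complex.re_ofReal_mul,
    ← Complex.exp_ofReal_mul_I_re]
  congr 3
  push_cast
  ring

/-- **`2K` Fourier coefficients determine a non-harmonic Fourier sum with at most `K`
non-`P`-periodic terms.** If two such sums (each with at most `K` terms, positive
amplitudes, pairwise distinct positive non-`P`-periodic frequencies, phases in `[0,2π)`)
have equal Fourier coefficients at `2K` pairwise distinct positive integer indices,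
then they agree identically on `ℝ`. -/
theorem statement13 (P : ℝ) (hP : 0 < P) (K K₁ K₂ : ℕ) (hK : 0 < K)
    (hK₁ : K₁ ≤ K) (hK₂ : K₂ ≤ K)
    (γ a b : Fin K₁ → ℝ) (δ c d : Fin K₂ → ℝ)
    (hγ : ∀ j, 0 < γ j) (ha : ∀ j, 0 < a j)
    (hainj : Function.Injective a) (hb : ∀ j, b j ∈ Set.Ico 0 (2 * π))
    (hanp : ∀ j, ∀ m : ℕ, a j * P ≠ (m : ℝ))
    (hδ : ∀ j, 0 < δ j) (hc : ∀ j, 0 < c j)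
    (hcinj : Function.Injective c) (hd : ∀ j, d j ∈ Set.Ico 0 (2 * π))
    (hcnp : ∀ j, ∀ m : ℕ, c j * P ≠ (m : ℝ))
    (f g : ℝ → ℝ)
    (hf : ∀ t, f t = ∑ j, γ j * Real.cos (2 * π * a j * t + b j))
    (hg : ∀ t, g t = ∑ j, δ j * Real.cos (2 * π * c j * t + d j))
    (idx : Fin (2 * K) → ℕ) (hidx : ∀ m, 0 < idx m)
    (hidxinj : Function.Injective idx)
    (heq : ∀ m, fourierCoef P f (idx m : ℤ) = fourierCoef P g (idx m : ℤ)) :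
    ∀ t : ℝ, f t = g t := by
  classical
  obtain rfl : f = _ := funext hf
  obtain rfl : g = _ := funext hg
  set S : Finset ℝ := univ.image a ∪ univ.image c with hS
  have haS : ∀ j, a j ∈ S := fun j => by simp [hS]
  have hcS : ∀ j, c j ∈ S := fun j => by simp [hS]
  have hcard : #S ≤ #(univ : Finset (Fin (2 * K))) := by
    have h₁ : #(univ.image a) ≤ K₁ := card_image_le.trans (by simp)
    have h₂ : #(univ.image c) ≤ K₂ := card_image_le.trans (by simp)
    have h₃ := card_union_le (univ.image a) (univ.image c)
    rw [card_univ, Fintype.card_fin, hS]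
    omega
  have hmem : ∀ x ∈ S, (∃ j, a j = x) ∨ ∃ j, c j = x := fun x hx => by simpa [hS] using hx
  set z : ℝ → ℂ := fun x => (∑ j with a j = x, (γ j : ℂ) * Complex.exp (b j * Complex.I)) -
    ∑ j with c j = x, (δ j : ℂ) * Complex.exp (d j * Complex.I) with hz
  have hdiff : ∀ t : ℝ, ∑ j, γ j * Real.cos (2 * π * a j * t + b j) -
      ∑ j, δ j * Real.cos (2 * π * c j * t + d j) =
      ∑ x ∈ S, (z x * Complex.exp (2 * π * x * t * Complex.I)).re := fun t => by
    rw [sum_mul_cos_eq_sum_re S γ a b haS, sum_mul_cos_eq_sum_re S δ c d hcS,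
      ← Finset.sum_sub_distrib]
    simp only [hz, sub_mul, Complex.sub_re]
  have hz0 : ∀ x ∈ S, z x = 0 := by
    refine amplitude_eq_zero_of_fourierCoef_eq_zero hP S z ?_ ?_ univ idx (fun k _ => hidx k)
      hidxinj.injOn hcard fun k _ => ?_
    · intro x hx
      obtain ⟨j, rfl⟩ | ⟨j, rfl⟩ := hmem x hx
      exacts [ha j, hc j]
    · intro x hx
      obtain ⟨j, rfl⟩ | ⟨j, rfl⟩ := hmem x hx
      exacts [hanp j, hcnp j]
    · simp_rw [← hdiff]
      rw [fourierCoef_sub P (by fun_prop) (by fun_prop), heq k, sub_self]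
  intro t
  refine sub_eq_zero.1 ((hdiff t).trans (Finset.sum_eq_zero fun x hx => ?_))
  rw [hz0 x hx, zero_mul, Complex.zero_re]
end
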